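/- If y ∈ ℝ is not of the form f(k/2^{2m}) for any balanced pair (k, m) of generation 1, then the set {x ∈ X ∩ [0, 1/2] : f(x) = y} contains at most one point. -/

import Mathlib

/-- `phi x` is the distance from `x` to the nearest integer. -/
noncomputable def phi (x : ℝ) : ℝ := |x - round x|

/-- The signed Takagi function associated to the sign sequence `r`. -/
noncomputable def takagi (r : ℕ → ℝ) (x : ℝ) : ℝ :=
  ∑' n : ℕ, r n / 2 ^ n * phi (2 ^ n * x)

/-- `eps n x` is the `n`-th binary digit of `x ∈ [0,1)` (for `n ≥ 1`), using the
terminating expansion for dyadic rationals. -/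
noncomputable def eps (n : ℕ) (x : ℝ) : ℕ := (⌊2 ^ n * x⌋ % 2).toNat

/-- `Dfun r k x = ∑_{j=1}^k r_{j-1} (-1)^{ε_j(x)}`. -/
noncomputable def Dfun (r : ℕ → ℝ) (k : ℕ) (x : ℝ) : ℝ :=
  ∑ j ∈ Finset.Icc 1 k, r (j - 1) * (-1 : ℝ) ^ eps j x

/-- `(k, m)` is a balanced pair if `0 ≤ k < 2^{2m}` and `D_{2m}(k/2^{2m}) = 0`. -/
def BalancedPair (r : ℕ → ℝ) (k m : ℕ) : Prop :=
  k < 2 ^ (2 * m) ∧ Dfun r (2 * m) ((k : ℝ) / 2 ^ (2 * m)) = 0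

/-- The generation of a balanced pair `(k, m)`: the number of indices
`1 ≤ j ≤ 2m` with `D_j(k/2^{2m}) = 0`. -/
noncomputable def generation (r : ℕ → ℝ) (k m : ℕ) : ℕ :=
  {j : ℕ | 1 ≤ j ∧ j ≤ 2 * m ∧ Dfun r j ((k : ℝ) / 2 ^ (2 * m)) = 0}.ncard

/-- The set `X = [0,1] \ ⋃ (k/2^{2m}, (k+1)/2^{2m})`, the union taken over all
balanced pairs `(k, m)` of generation `1`. -/
noncomputable def XSet (r : ℕ → ℝ) : Set ℝ :=
  Set.Icc (0 : ℝ) 1 \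
    ⋃ p : ℕ × ℕ, ⋃ _ : BalancedPair r p.1 p.2 ∧ generation r p.1 p.2 = 1,
      Set.Ioo ((p.1 : ℝ) / 2 ^ (2 * p.2)) (((p.1 : ℝ) + 1) / 2 ^ (2 * p.2))

theorem phi_natCast (n : ℕ) : phi n = 0 := by
  simp [phi]

/-- On `[i / 2, (i + 1) / 2]` the function `phi` is affine, with slope `(-1) ^ i`. -/
theorem phi_sub_phi (i : ℕ) {u v : ℝ} (hu : (i : ℝ) / 2 ≤ u) (hu' : u ≤ ((i : ℝ) + 1) / 2)
    (hv : (i : ℝ) / 2 ≤ v) (hv' : v ≤ ((i : ℝ) + 1) / 2) :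
    phi v - phi u = (-1) ^ i * (v - u) := by
  have key : ∀ w : ℝ, (i : ℝ) / 2 ≤ w → w ≤ ((i : ℝ) + 1) / 2 →
      phi w = (-1) ^ i * (w - ((i : ℝ) + (i % 2 : ℕ)) / 2) := by
    intro w hw hw'
    obtain ⟨l, rfl | rfl⟩ := Nat.even_or_odd' i
    · push_cast at hw hw'
      have h1 : phi w = |(w - l) - round (w - l)| := by
        simp [phi]
      rcases eq_or_lt_of_le hw' with h | h
      · rw [h1, h]
        have : (2 * (l : ℝ) + 1) / 2 - l = 2⁻¹ := by ring
        rw [this, round_two_inv]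
        norm_num
        ring
      · have : round (w - l) = 0 := by
          rw [round_eq_zero_iff]
          constructor <;> linarith
        rw [h1, this]
        simp
        exact (by linarith : (l : ℝ) ≤ w)
    · push_cast at hw hw'
      have h1 : phi w = |(w - (l + 1)) - round (w - (l + 1))| := by
        have := round_sub_intCast w (l + 1)
        push_cast at this
        simp [phi, this]
      have : round (w - (l + 1)) = 0 := by
        rw [round_eq_zero_iff]
        constructor <;> linarith
      have h2 : (2 * l + 1) % 2 = 1 := by omega
      rw [h1, this, h2, pow_succ, pow_mul]
      simp only [Int.cast_zero, sub_zero]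
      rw [abs_of_nonpos (by linarith)]
      push_cast
      norm_num
      ring
  rw [key v hv hv', key u hu hu']
  ring

theorem eps_dyadic {j n : ℕ} (h : j ≤ n) (k : ℕ) :
    eps j ((k : ℝ) / 2 ^ n) = k / 2 ^ (n - j) % 2 := by
  obtain ⟨l, rfl⟩ := Nat.exists_eq_add_of_le h
  have : (2 : ℝ) ^ j * (k / 2 ^ (j + l)) = (k : ℝ) / (2 ^ l : ℕ) := by
    push_cast
    field_simp
    ring
  rw [eps, this, ← Int.natCast_floor_eq_floor (by positivity), Nat.floor_div_natCast,
    Nat.floor_natCast, Nat.add_sub_cancel_left]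
  omega

theorem Dfun_add_one (r : ℕ → ℝ) (n : ℕ) (x : ℝ) :
    Dfun r (n + 1) x = Dfun r n x + r n * (-1) ^ eps (n + 1) x := by
  rw [Dfun, Finset.sum_Icc_succ_top (by omega)]
  simp [Dfun]

theorem Dfun_eq_sum_range (r : ℕ → ℝ) (n : ℕ) (x : ℝ) :
    Dfun r n x = ∑ j ∈ Finset.range n, r j * (-1) ^ eps (j + 1) x := by
  induction n with
  | zero => simp [Dfun]
  | succ n ih => rw [Dfun_add_one, ih, Finset.sum_range_succ]

/-- `Dfun r j` at a dyadic point of level `n ≥ j` only depends on the parent dyadic interval. -/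
theorem Dfun_child (r : ℕ → ℝ) {j n : ℕ} (h : j ≤ n) (c : ℕ) :
    Dfun r j ((c : ℝ) / 2 ^ (n + 1)) = Dfun r j (((c / 2 : ℕ) : ℝ) / 2 ^ n) := by
  unfold Dfun
  refine Finset.sum_congr rfl fun i hi => ?_
  have hi := (Finset.mem_Icc.1 hi).2
  rw [eps_dyadic (by omega), eps_dyadic (by omega), Nat.div_div_eq_div_mul, ← pow_succ',
    show n + 1 - i = n - i + 1 by omega]

theorem Dfun_succ (r : ℕ → ℝ) (n c : ℕ) :
    Dfun r (n + 1) ((c : ℝ) / 2 ^ (n + 1)) =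
      Dfun r n (((c / 2 : ℕ) : ℝ) / 2 ^ n) + r n * (-1) ^ (c % 2) := by
  rw [Dfun_add_one, ← Dfun_child r le_rfl, eps_dyadic le_rfl]
  simp

theorem exists_int_Dfun {r : ℕ → ℝ} (hr : ∀ n, r n = 1 ∨ r n = -1) (n : ℕ) (x : ℝ) :
    ∃ z : ℤ, Dfun r n x = z ∧ z % 2 = n % 2 := by
  induction n with
  | zero => exact ⟨0, by simp [Dfun]⟩
  | succ n ih =>
    obtain ⟨z, hz, hz2⟩ := ih
    have : r n * (-1) ^ eps (n + 1) x = 1 ∨ r n * (-1) ^ eps (n + 1) x = -1 := by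
      rcases hr n with h | h <;> rcases neg_one_pow_eq_or ℝ (eps (n + 1) x) with h' | h' <;>
        simp [h, h']
    rcases this with h | h
    · exact ⟨z + 1, by rw [Dfun_add_one, hz, h]; push_cast; ring, by push_cast; omega⟩
    · exact ⟨z - 1, by rw [Dfun_add_one, hz, h]; push_cast; ring, by push_cast; omega⟩

theorem takagi_dyadic (r : ℕ → ℝ) (n k : ℕ) :
    takagi r ((k : ℝ) / 2 ^ n) =
      ∑ j ∈ Finset.range n, r j / 2 ^ j * phi (2 ^ j * ((k : ℝ) / 2 ^ n)) := by
  refine tsum_eq_sum fun j hj => ?_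
  obtain ⟨l, rfl⟩ := Nat.exists_eq_add_of_le (not_lt.1 (mt Finset.mem_range.2 hj))
  have : (2 : ℝ) ^ (n + l) * (k / 2 ^ n) = (2 ^ l * k : ℕ) := by
    push_cast
    field_simp
    ring
  rw [this, phi_natCast, mul_zero]

/-- The increment of the signed Takagi function over a dyadic interval. -/
theorem takagi_increment (r : ℕ → ℝ) (n k : ℕ) :
    takagi r (((k : ℝ) + 1) / 2 ^ n) - takagi r ((k : ℝ) / 2 ^ n) =
      Dfun r n ((k : ℝ) / 2 ^ n) / 2 ^ n := by
  have h1 := takagi_dyadic r n (k + 1)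
  push_cast at h1
  rw [h1, takagi_dyadic, ← Finset.sum_sub_distrib, Dfun_eq_sum_range, Finset.sum_div]
  refine Finset.sum_congr rfl fun j hj => ?_
  obtain ⟨l, rfl⟩ := Nat.exists_eq_add_of_lt (Finset.mem_range.1 hj)
  have hscale : ∀ w : ℝ, 2 ^ j * (w / 2 ^ (j + l + 1)) = w / 2 ^ l / 2 := by
    intro w
    field_simp
    ring
  have hl : (0 : ℝ) < 2 ^ l := by positivity
  have h2 : ((k / 2 ^ l : ℕ) : ℝ) * 2 ^ l ≤ k := by
    exact_mod_cast Nat.div_mul_le_self k (2 ^ l)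
  have h3 : (k : ℝ) + 1 ≤ ((k / 2 ^ l : ℕ) + 1) * 2 ^ l := by
    exact_mod_cast Nat.lt_mul_of_div_lt (Nat.lt_succ_self _) (by positivity)
  have h4 : phi ((k + 1) / 2 ^ l / 2) - phi (k / 2 ^ l / 2) =
      (-1) ^ (k / 2 ^ l) * (((k : ℝ) + 1) / 2 ^ l / 2 - k / 2 ^ l / 2) := by
    apply phi_sub_phi <;> gcongr
    · rwa [le_div_iff₀ hl]
    · rw [div_le_iff₀ hl]
      linarith
    · rw [le_div_iff₀ hl]
      linarith
    · rwa [div_le_iff₀ hl]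
  rw [hscale, hscale, ← mul_sub, h4, eps_dyadic (by omega), ← neg_one_pow_eq_pow_mod_two,
    show j + l + 1 - (j + 1) = l by omega]
  field_simp
  ring

theorem continuous_phi : Continuous phi := by
  have : phi = fun x : ℝ => ‖(x : UnitAddCircle)‖ := by
    ext x
    rw [UnitAddCircle.norm_eq, phi]
  rw [this]
  exact continuous_norm.comp (AddCircle.continuous_mk' 1)

theorem continuous_takagi {r : ℕ → ℝ} (hr : ∀ n, r n = 1 ∨ r n = -1) :
    Continuous (takagi r) := by
  refine continuous_tsum (u := fun n => (1 / 2 : ℝ) ^ n)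
    (fun n => continuous_const.mul (continuous_phi.comp (continuous_const.mul continuous_id)))
    (summable_geometric_of_lt_one (by norm_num) (by norm_num)) fun n x => ?_
  have h1 : |r n| = 1 := by rcases hr n with h | h <;> simp [h]
  have h2 : |phi (2 ^ n * x)| ≤ 1 := by
    rw [phi, abs_abs]
    exact (abs_sub_round _).trans (by norm_num)
  rw [Real.norm_eq_abs, abs_mul, abs_div, h1, abs_of_pos (by positivity : (0 : ℝ) < 2 ^ n),
    one_div_pow]
  exact mul_le_of_le_one_right (by positivity) h2

theorem two_mul_div_two_pow_succ (k n : ℕ) :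
    ((2 * k : ℕ) : ℝ) / 2 ^ (n + 1) = k / 2 ^ n := by
  push_cast
  field_simp
  ring

theorem takagi_midpoint_sub_left (r : ℕ → ℝ) (n k : ℕ) :
    takagi r (((2 * k + 1 : ℕ) : ℝ) / 2 ^ (n + 1)) - takagi r ((k : ℝ) / 2 ^ n) =
      Dfun r (n + 1) (((2 * k : ℕ) : ℝ) / 2 ^ (n + 1)) / 2 ^ (n + 1) := by
  rw [← takagi_increment, ← two_mul_div_two_pow_succ k n]
  push_cast
  rfl

theorem takagi_right_sub_midpoint (r : ℕ → ℝ) (n k : ℕ) :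
    takagi r (((k : ℝ) + 1) / 2 ^ n) - takagi r (((2 * k + 1 : ℕ) : ℝ) / 2 ^ (n + 1)) =
      Dfun r (n + 1) (((2 * k + 1 : ℕ) : ℝ) / 2 ^ (n + 1)) / 2 ^ (n + 1) := by
  rw [← takagi_increment]
  have := two_mul_div_two_pow_succ (k + 1) n
  push_cast at this ⊢
  rw [← this]
  ring_nf

/-- Up to the sign `r 0`, the walk `j ↦ Dfun r j (k / 2 ^ n)` is positive for `1 ≤ j ≤ n`. -/
def PositiveWalk (r : ℕ → ℝ) (n k : ℕ) : Prop :=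
  ∀ j, 1 ≤ j → j ≤ n → 0 < r 0 * Dfun r j ((k : ℝ) / 2 ^ n)

theorem PositiveWalk.child_nonneg {r : ℕ → ℝ} (hr : ∀ n, r n = 1 ∨ r n = -1) {n c : ℕ}
    (hn : 1 ≤ n) (h : PositiveWalk r n (c / 2)) :
    0 ≤ r 0 * Dfun r (n + 1) ((c : ℝ) / 2 ^ (n + 1)) := by
  have h := h n hn le_rfl
  obtain ⟨z, hz, -⟩ := exists_int_Dfun hr n (((c / 2 : ℕ) : ℝ) / 2 ^ n)
  rw [Dfun_succ]
  rw [hz] at h ⊢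
  have h1 : 1 ≤ r 0 * (z : ℝ) := by
    rcases hr 0 with h0 | h0 <;> rw [h0] at h ⊢
    · have : 0 < z := by exact_mod_cast (by linarith : (0 : ℝ) < z)
      have : (1 : ℝ) ≤ z := by exact_mod_cast this
      linarith
    · have : z < 0 := by exact_mod_cast (by linarith : (z : ℝ) < 0)
      have : (z : ℝ) ≤ -1 := by exact_mod_cast Int.le_sub_one_of_lt this
      linarith
  rcases hr 0 with h0 | h0 <;> rcases hr n with h2 | h2 <;>
    rcases neg_one_pow_eq_or ℝ (c % 2) with h3 | h3 <;>
    rw [h0] at h1 <;> rw [h0, h2, h3] <;> linarith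

theorem PositiveWalk.child {r : ℕ → ℝ} {n c : ℕ} (h : PositiveWalk r n (c / 2))
    (hc : 0 < r 0 * Dfun r (n + 1) ((c : ℝ) / 2 ^ (n + 1))) : PositiveWalk r (n + 1) c := by
  intro j hj hjn
  rcases Nat.of_le_succ hjn with hjn | rfl
  · rw [Dfun_child r hjn]
    exact h j hj hjn
  · exact hc

/-- The first return of a positive walk to zero gives a balanced pair of generation one. -/
theorem PositiveWalk.exists_balancedPair {r : ℕ → ℝ} (hr : ∀ n, r n = 1 ∨ r n = -1) {n c : ℕ}
    (h : PositiveWalk r n (c / 2)) (hcn : c < 2 ^ (n + 1))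
    (hc : Dfun r (n + 1) ((c : ℝ) / 2 ^ (n + 1)) = 0) :
    ∃ m, n + 1 = 2 * m ∧ BalancedPair r c m ∧ generation r c m = 1 := by
  obtain ⟨z, hz, hz2⟩ := exists_int_Dfun hr (n + 1) ((c : ℝ) / 2 ^ (n + 1))
  rw [hc] at hz
  have hz0 : z = 0 := by exact_mod_cast hz.symm
  obtain ⟨m, hm⟩ : ∃ m, n + 1 = 2 * m := ⟨(n + 1) / 2, by omega⟩
  refine ⟨m, hm, ⟨hm ▸ hcn, hm ▸ hc⟩, ?_⟩
  rw [generation, ← hm, Set.ncard_eq_one]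
  refine ⟨n + 1, Set.eq_singleton_iff_unique_mem.2 ⟨⟨by omega, le_rfl, hc⟩, ?_⟩⟩
  rintro j ⟨hj, hjn, hj0⟩
  by_contra hne
  have hjn : j ≤ n := by omega
  rw [Dfun_child r hjn] at hj0
  have := h j hj hjn
  rw [hj0, mul_zero] at this
  exact lt_irrefl _ this

/-- Indices of a nested sequence of closed dyadic intervals containing `x ∈ [0, 1]`, preferring
the left half where both halves contain `x`. -/
noncomputable def dyadicPath (x : ℝ) : ℕ → ℕ
  | 0 => 0
  | n + 1 => if x ≤ ((2 * dyadicPath x n + 1 : ℕ) : ℝ) / 2 ^ (n + 1) then 2 * dyadicPath x n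
      else 2 * dyadicPath x n + 1

theorem dyadicPath_succ_cases (x : ℝ) (n : ℕ) :
    (x ≤ ((2 * dyadicPath x n + 1 : ℕ) : ℝ) / 2 ^ (n + 1) ∧
      dyadicPath x (n + 1) = 2 * dyadicPath x n) ∨
    (((2 * dyadicPath x n + 1 : ℕ) : ℝ) / 2 ^ (n + 1) < x ∧
      dyadicPath x (n + 1) = 2 * dyadicPath x n + 1) := by
  rw [dyadicPath]
  split_ifs with h
  · exact Or.inl ⟨h, rfl⟩
  · exact Or.inr ⟨not_le.1 h, rfl⟩

theorem dyadicPath_succ_div_two (x : ℝ) (n : ℕ) :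
    dyadicPath x (n + 1) / 2 = dyadicPath x n := by
  rcases dyadicPath_succ_cases x n with ⟨-, h⟩ | ⟨-, h⟩ <;> omega

theorem dyadicPath_lt (x : ℝ) (n : ℕ) : dyadicPath x n < 2 ^ n := by
  induction n with
  | zero => simp [dyadicPath]
  | succ n ih =>
    have := dyadicPath_succ_div_two x n
    rw [pow_succ]
    omega

theorem mem_Icc_dyadicPath {x : ℝ} (hx : x ∈ Set.Icc (0 : ℝ) 1) (n : ℕ) :
    x ∈ Set.Icc ((dyadicPath x n : ℝ) / 2 ^ n) (((dyadicPath x n : ℝ) + 1) / 2 ^ n) := by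
  induction n with
  | zero => simpa [dyadicPath] using hx
  | succ n ih =>
    have h0 := two_mul_div_two_pow_succ (dyadicPath x n) n
    have h1 := two_mul_div_two_pow_succ (dyadicPath x n + 1) n
    push_cast at h0 h1
    rw [← h0, ← h1] at ih
    rcases dyadicPath_succ_cases x n with ⟨h, h'⟩ | ⟨h, h'⟩ <;> rw [h'] <;> push_cast at h ⊢
    · exact ⟨ih.1, h⟩
    · exact ⟨h.le, ih.2.trans_eq (by ring)⟩

theorem tendsto_dyadicPath_left {x : ℝ} (hx : x ∈ Set.Icc (0 : ℝ) 1) :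
    Filter.Tendsto (fun n => (dyadicPath x n : ℝ) / 2 ^ n) Filter.atTop (nhds x) := by
  have h : Filter.Tendsto (fun n : ℕ => x - (1 / 2 : ℝ) ^ n) Filter.atTop (nhds x) := by
    simpa using tendsto_const_nhds.sub
      (tendsto_pow_atTop_nhds_zero_of_lt_one (r := (1 / 2 : ℝ)) (by norm_num) (by norm_num))
  refine tendsto_of_tendsto_of_tendsto_of_le_of_le h tendsto_const_nhds (fun n => ?_)
    fun n => (mem_Icc_dyadicPath hx n).1
  have := (mem_Icc_dyadicPath hx n).2
  rw [add_div] at this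
  simp only [one_div_pow]
  linarith

theorem tendsto_dyadicPath_right {x : ℝ} (hx : x ∈ Set.Icc (0 : ℝ) 1) :
    Filter.Tendsto (fun n => ((dyadicPath x n : ℝ) + 1) / 2 ^ n) Filter.atTop (nhds x) := by
  have h : Filter.Tendsto (fun n : ℕ => (1 / 2 : ℝ) ^ n) Filter.atTop (nhds 0) :=
    tendsto_pow_atTop_nhds_zero_of_lt_one (by norm_num) (by norm_num)
  simpa [add_div] using (tendsto_dyadicPath_left hx).add h

theorem takagi_dyadicPath_bounds {r : ℕ → ℝ} (hr : ∀ n, r n = 1 ∨ r n = -1) {x : ℝ}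
    (hx : x ∈ Set.Icc (0 : ℝ) 1) (hpos : ∀ n, 1 ≤ n → PositiveWalk r n (dyadicPath x n))
    {n : ℕ} (hn : 1 ≤ n) :
    r 0 * takagi r ((dyadicPath x n : ℝ) / 2 ^ n) ≤ r 0 * takagi r x ∧
      r 0 * takagi r x ≤ r 0 * takagi r (((dyadicPath x n : ℝ) + 1) / 2 ^ n) := by
  have hcont : Continuous fun w => r 0 * takagi r w :=
    continuous_const.mul (continuous_takagi hr)
  have hstep : ∀ l, 1 ≤ l →
      r 0 * takagi r ((dyadicPath x l : ℝ) / 2 ^ l) ≤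
        r 0 * takagi r ((dyadicPath x (l + 1) : ℝ) / 2 ^ (l + 1)) ∧
      r 0 * takagi r (((dyadicPath x (l + 1) : ℝ) + 1) / 2 ^ (l + 1)) ≤
        r 0 * takagi r (((dyadicPath x l : ℝ) + 1) / 2 ^ l) := by
    intro l hl
    rcases dyadicPath_succ_cases x l with ⟨-, h⟩ | ⟨-, h⟩ <;> rw [h]
    · rw [two_mul_div_two_pow_succ]
      refine ⟨le_rfl, ?_⟩
      have h1 := takagi_right_sub_midpoint r l (dyadicPath x l)
      have h2 := PositiveWalk.child_nonneg hr (c := 2 * dyadicPath x l + 1) hl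
        (by simpa [Nat.mul_add_div] using hpos l hl)
      have h3 := div_nonneg h2 (by positivity : (0 : ℝ) ≤ 2 ^ (l + 1))
      rw [mul_div_assoc, ← h1] at h3
      push_cast at h3 ⊢
      linarith
    · have h1 := takagi_midpoint_sub_left r l (dyadicPath x l)
      have h2 := PositiveWalk.child_nonneg hr (c := 2 * dyadicPath x l) hl
        (by simpa using hpos l hl)
      have h3 := div_nonneg h2 (by positivity : (0 : ℝ) ≤ 2 ^ (l + 1))
      rw [mul_div_assoc, ← h1] at h3
      refine ⟨by linarith, le_of_eq ?_⟩
      rw [← Nat.cast_add_one, ← Nat.cast_add_one,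
        show 2 * dyadicPath x l + 1 + 1 = 2 * (dyadicPath x l + 1) by ring,
        two_mul_div_two_pow_succ]
  constructor
  · refine ge_of_tendsto ((hcont.tendsto x).comp (tendsto_dyadicPath_left hx)) ?_
    filter_upwards [Filter.eventually_ge_atTop n] with N hN
    induction N, hN using Nat.le_induction with
    | base => exact le_rfl
    | succ l hl ih => exact ih.trans (hstep l (hn.trans hl)).1
  · refine le_of_tendsto ((hcont.tendsto x).comp (tendsto_dyadicPath_right hx)) ?_
    filter_upwards [Filter.eventually_ge_atTop n] with N hN
    induction N, hN using Nat.le_induction with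
    | base => exact le_rfl
    | succ l hl ih => exact (hstep l (hn.trans hl)).2.trans ih

theorem dyadicPath_one {x : ℝ} (hx : x ≤ 1 / 2) : dyadicPath x 1 = 0 := by
  rw [dyadicPath, dyadicPath, if_pos]
  simpa using hx

/-- A point of `XSet r` in `[0, 1 / 2]` whose value is not attained at the left end of a balanced
interval of generation one has a positive walk. -/
theorem positiveWalk_dyadicPath {r : ℕ → ℝ} (hr : ∀ n, r n = 1 ∨ r n = -1) {x : ℝ}
    (hy : ∀ k m : ℕ, BalancedPair r k m → generation r k m = 1 →
      takagi r ((k : ℝ) / 2 ^ (2 * m)) ≠ takagi r x)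
    (hX : x ∈ XSet r) (hx : x ≤ 1 / 2) {n : ℕ} (hn : 1 ≤ n) :
    PositiveWalk r n (dyadicPath x n) := by
  induction n, hn using Nat.le_induction with
  | base =>
    intro j hj hj1
    obtain rfl : j = 1 := by omega
    rw [dyadicPath_one hx]
    rcases hr 0 with h | h <;> simp [Dfun, eps, h]
  | succ n hn ih =>
    rw [← dyadicPath_succ_div_two] at ih
    refine ih.child ((ih.child_nonneg hr hn).lt_of_ne' fun h0 => ?_)
    have hr0 : r 0 ≠ 0 := by rcases hr 0 with h | h <;> simp [h]
    have hD := (mul_eq_zero.1 h0).resolve_left hr0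
    obtain ⟨m, hm, hb, hg⟩ := ih.exists_balancedPair hr (dyadicPath_lt x _) hD
    have hmem := mem_Icc_dyadicPath hX.1 (n + 1)
    have hinc := takagi_increment r (n + 1) (dyadicPath x (n + 1))
    have hne := hy _ m hb hg
    rw [hD, zero_div] at hinc
    rw [← hm] at hne
    refine hX.2 (Set.mem_iUnion₂.2 ⟨(dyadicPath x (n + 1), m), ⟨hb, hg⟩, ?_⟩)
    rw [← hm]
    refine ⟨hmem.1.lt_of_ne fun h => hne (by rw [h]), hmem.2.lt_of_ne fun h => hne ?_⟩
    rw [← h] at hinc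
    exact (sub_eq_zero.1 hinc).symm

theorem takagi_ne_of_lt {r : ℕ → ℝ} (hr : ∀ n, r n = 1 ∨ r n = -1) {x x' : ℝ}
    (hy : ∀ k m : ℕ, BalancedPair r k m → generation r k m = 1 →
      takagi r ((k : ℝ) / 2 ^ (2 * m)) ≠ takagi r x)
    (hX : x ∈ XSet r) (hX' : x' ∈ XSet r) (hx' : x' ≤ 1 / 2) (hlt : x < x') :
    takagi r x ≠ takagi r x' := by
  intro hf
  have hr0 : r 0 ≠ 0 := by rcases hr 0 with h | h <;> simp [h]
  have hx : x ≤ 1 / 2 := hlt.le.trans hx'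
  have hp := fun n => positiveWalk_dyadicPath hr hy hX hx (n := n)
  have hq := fun n => positiveWalk_dyadicPath hr (hf ▸ hy) hX' hx' (n := n)
  -- the last level at which both points lie in the same interval
  obtain ⟨n, hn, hpq, hpq'⟩ : ∃ n, 1 ≤ n ∧ dyadicPath x n = dyadicPath x' n ∧
      dyadicPath x (n + 1) ≠ dyadicPath x' (n + 1) := by
    by_contra! H
    have heq : ∀ n, 1 ≤ n → dyadicPath x n = dyadicPath x' n := by
      intro n hn
      induction n, hn using Nat.le_induction with
      | base => rw [dyadicPath_one hx, dyadicPath_one hx']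
      | succ n hn ih => exact H n hn ih
    refine hlt.ne (tendsto_nhds_unique (tendsto_dyadicPath_left hX.1)
      ((tendsto_dyadicPath_left hX'.1).congr' ?_))
    filter_upwards [Filter.eventually_ge_atTop 1] with l hl
    rw [heq l hl]
  set k := dyadicPath x n
  set M : ℝ := ((2 * k + 1 : ℕ) : ℝ) / 2 ^ (n + 1) with hM
  obtain ⟨hpk, hqk, hMx'⟩ : dyadicPath x (n + 1) = 2 * k ∧
      dyadicPath x' (n + 1) = 2 * k + 1 ∧ M < x' := by
    have h1 := dyadicPath_succ_cases x n
    have h2 := dyadicPath_succ_cases x' n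
    rw [← hpq] at h2
    rcases h1 with ⟨h1, h1'⟩ | ⟨h1, h1'⟩ <;> rcases h2 with ⟨h2, h2'⟩ | ⟨h2, h2'⟩
    · exact absurd (h1'.trans h2'.symm) hpq'
    · exact ⟨h1', h2', h2⟩
    · exact absurd (h1.trans hlt) (not_lt.2 h2)
    · exact absurd (h1'.trans h2'.symm) hpq'
  have hxM := (takagi_dyadicPath_bounds hr hX.1 hp (Nat.succ_pos n)).2
  have hqb := fun l (hl : 1 ≤ l) => (takagi_dyadicPath_bounds hr hX'.1 hq hl).1
  rw [hpk, ← Nat.cast_add_one] at hxM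
  -- the first turn to the right of the path of `x'` after passing the midpoint `M`
  obtain ⟨N, hN, hNM, hturn⟩ : ∃ N, n + 1 ≤ N ∧ (dyadicPath x' N : ℝ) / 2 ^ N = M ∧
      dyadicPath x' (N + 1) = 2 * dyadicPath x' N + 1 := by
    by_contra! H
    have heq : ∀ l, n + 1 ≤ l → (dyadicPath x' l : ℝ) / 2 ^ l = M := by
      intro l hl
      induction l, hl using Nat.le_induction with
      | base => rw [hqk]
      | succ l hl ih =>
        rcases dyadicPath_succ_cases x' l with ⟨-, h⟩ | ⟨-, h⟩
        · rw [h, two_mul_div_two_pow_succ, ih]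
        · exact absurd h (H l hl ih)
    refine hMx'.ne (tendsto_nhds_unique (tendsto_const_nhds.congr' ?_)
      (tendsto_dyadicPath_left hX'.1))
    filter_upwards [Filter.eventually_ge_atTop (n + 1)] with l hl
    rw [heq l hl]
  have hN1 : 1 ≤ N := by omega
  have hwalk : PositiveWalk r N (2 * dyadicPath x' N / 2) := by simpa using hq N hN1
  have hmid := hqb (N + 1) (by omega)
  have hinc := takagi_midpoint_sub_left r N (dyadicPath x' N)
  have hnonneg := hwalk.child_nonneg hr hN1
  rw [hturn] at hmid
  rw [hNM] at hinc
  have hMb := hqb N hN1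
  rw [hNM] at hMb
  have hfM : takagi r M = takagi r x :=
    mul_left_cancel₀ hr0 (le_antisymm (by rw [hf]; exact hMb) hxM)
  have hpow : (0 : ℝ) < 2 ^ (N + 1) := by positivity
  rw [eq_div_iff hpow.ne'] at hinc
  have hzero : Dfun r (N + 1) (((2 * dyadicPath x' N : ℕ) : ℝ) / 2 ^ (N + 1)) = 0 := by
    refine (mul_eq_zero.1 (le_antisymm ?_ hnonneg)).resolve_left hr0
    rw [← hinc, ← mul_assoc]
    refine mul_nonpos_of_nonpos_of_nonneg ?_ hpow.le
    rw [mul_sub, hfM, hf]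
    linarith
  obtain ⟨m, hm, hb, hg⟩ := hwalk.exists_balancedPair hr
    (by have := dyadicPath_lt x' N; rw [pow_succ]; omega) hzero
  refine hy _ m hb hg ?_
  rw [← hm, two_mul_div_two_pow_succ, hNM, hfM]

/-- If `y` is not the value of `f` at the left endpoint `k/2^{2m}` of any
balanced pair of generation `1`, then the level set of `y` meets
`X ∩ [0, 1/2]` in at most one point. -/
theorem level_set_meets_XSet_in_at_most_one_point
    (r : ℕ → ℝ) (hr : ∀ n, r n = 1 ∨ r n = -1) (y : ℝ)
    (hy : ∀ k m : ℕ, BalancedPair r k m → generation r k m = 1 →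
      takagi r ((k : ℝ) / 2 ^ (2 * m)) ≠ y) :
    {x ∈ XSet r ∩ Set.Icc (0 : ℝ) (1 / 2) | takagi r x = y}.encard ≤ 1 := by
  rw [Set.encard_le_one_iff]
  rintro a b ⟨⟨haX, ha⟩, rfl⟩ ⟨⟨hbX, hb⟩, hab⟩
  by_contra hne
  rcases lt_or_gt_of_ne hne with h | h
  · exact takagi_ne_of_lt hr hy haX hbX hb.2 h hab.symm
  · exact takagi_ne_of_lt hr (hab ▸ hy) hbX haX ha.2 h hab
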